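/- arXiv:2311.05762 — 3 statements merged into one kernel-verified Lean document; each statement's English description precedes it below -/
import Mathlib

section
/- Let X, Y, Z be independent finitely supported random variables taking values in an abelian group G. Then H[X + Y + Z] − H[X + Y] ≤ H[Y + Z] − H[Y]. -/
open scoped Classical BigOperators Pointwise
open Finset

noncomputable section

/-- The probability that the random variable `X` equals `s`, under the pmf `μ`. -/
def pmass {Ω S : Type*} [Fintype Ω] (μ : Ω → ℝ) (X : Ω → S) (s : S) : ℝ :=
  ∑ ω, if X ω = s then μ ω else 0

/-- `μ` is a probability mass function on the finite type `Ω`. -/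
def IsProb {Ω : Type*} [Fintype Ω] (μ : Ω → ℝ) : Prop :=
  (∀ ω, 0 ≤ μ ω) ∧ ∑ ω, μ ω = 1

/-- Shannon entropy `H[X]` of a random variable `X : Ω → S` under `μ`. -/
def ent {Ω S : Type*} [Fintype Ω] (μ : Ω → ℝ) (X : Ω → S) : ℝ :=
  ∑ s ∈ Finset.univ.image X, Real.negMulLog (pmass μ X s)

/-- Mutual information `I[X : Y]`. -/
def mutualInfo {Ω S T : Type*} [Fintype Ω] (μ : Ω → ℝ) (X : Ω → S) (Y : Ω → T) : ℝ :=
  ent μ X + ent μ Y - ent μ (fun ω => (X ω, Y ω))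

/-- The conditional measure, conditioning on the event `Y = y`. -/
def condMeas {Ω T : Type*} [Fintype Ω] (μ : Ω → ℝ) (Y : Ω → T) (y : T) : Ω → ℝ :=
  fun ω => if Y ω = y then μ ω / pmass μ Y y else 0

/-- Conditional mutual information `I[X : Y | Z]`. -/
def condMutualInfo {Ω S T U : Type*} [Fintype Ω] (μ : Ω → ℝ)
    (X : Ω → S) (Y : Ω → T) (Z : Ω → U) : ℝ :=
  ∑ z ∈ Finset.univ.image Z, pmass μ Z z * mutualInfo (condMeas μ Z z) X Y

/-- Entropic Ruzsa distance `d[X ; Y]`, defined via independent copies on a product space. -/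
def rdist {Ω₁ Ω₂ G : Type*} [Fintype Ω₁] [Fintype Ω₂] [AddCommGroup G]
    (μ₁ : Ω₁ → ℝ) (X : Ω₁ → G) (μ₂ : Ω₂ → ℝ) (Y : Ω₂ → G) : ℝ :=
  ent (fun p : Ω₁ × Ω₂ => μ₁ p.1 * μ₂ p.2) (fun p => X p.1 - Y p.2)
    - ent μ₁ X / 2 - ent μ₂ Y / 2

/-- Conditional Ruzsa distance `d[X | Z ; Y | W]`. -/
def condRdist {Ω₁ Ω₂ G T U : Type*} [Fintype Ω₁] [Fintype Ω₂] [AddCommGroup G]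
    (μ₁ : Ω₁ → ℝ) (X : Ω₁ → G) (Z : Ω₁ → T)
    (μ₂ : Ω₂ → ℝ) (Y : Ω₂ → G) (W : Ω₂ → U) : ℝ :=
  ∑ z ∈ Finset.univ.image Z, ∑ w ∈ Finset.univ.image W,
    pmass μ₁ Z z * pmass μ₂ W w * rdist (condMeas μ₁ Z z) X (condMeas μ₂ W w) Y

/-- Conditional Ruzsa distance `d[X ; Y | W]`, conditioning only on the right variable. -/
def condRdistRight {Ω₁ Ω₂ G U : Type*} [Fintype Ω₁] [Fintype Ω₂] [AddCommGroup G]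
    (μ₁ : Ω₁ → ℝ) (X : Ω₁ → G)
    (μ₂ : Ω₂ → ℝ) (Y : Ω₂ → G) (W : Ω₂ → U) : ℝ :=
  ∑ w ∈ Finset.univ.image W, pmass μ₂ W w * rdist μ₁ X (condMeas μ₂ W w) Y

/-- The uniform probability mass function on a subset `H` of a finite type. -/
def unifOn {G : Type*} [Fintype G] (H : Set G) : G → ℝ :=
  fun g => if g ∈ H then ((Nat.card H : ℝ))⁻¹ else 0

/-- `X` (under `μ₁`) and `Y` (under `μ₂`) are identically distributed. -/
def IdentDist {Ω₁ Ω₂ S : Type*} [Fintype Ω₁] [Fintype Ω₂]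
    (μ₁ : Ω₁ → ℝ) (X : Ω₁ → S) (μ₂ : Ω₂ → ℝ) (Y : Ω₂ → S) : Prop :=
  ∀ s, pmass μ₁ X s = pmass μ₂ Y s

/-- Two random variables are independent. -/
def IndepPair {Ω S T : Type*} [Fintype Ω] (μ : Ω → ℝ) (X : Ω → S) (Y : Ω → T) : Prop :=
  ∀ s t, pmass μ (fun ω => (X ω, Y ω)) (s, t) = pmass μ X s * pmass μ Y t

/-- Three random variables are jointly independent. -/
def IndepTriple {Ω S T U : Type*} [Fintype Ω] (μ : Ω → ℝ)
    (X : Ω → S) (Y : Ω → T) (Z : Ω → U) : Prop :=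
  ∀ s t u, pmass μ (fun ω => (X ω, Y ω, Z ω)) (s, t, u)
    = pmass μ X s * pmass μ Y t * pmass μ Z u

/-- Four random variables are jointly independent. -/
def IndepFour {Ω S T U V : Type*} [Fintype Ω] (μ : Ω → ℝ)
    (X : Ω → S) (Y : Ω → T) (Z : Ω → U) (W : Ω → V) : Prop :=
  ∀ s t u v, pmass μ (fun ω => (X ω, Y ω, Z ω, W ω)) (s, t, u, v)
    = pmass μ X s * pmass μ Y t * pmass μ Z u * pmass μ W v


lemma kv_pmass_nonneg {Ω S : Type*} [Fintype Ω] {μ : Ω → ℝ} (hμ : IsProb μ) (X : Ω → S) (s : S) :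
    0 ≤ pmass μ X s := by
  unfold pmass
  exact Finset.sum_nonneg fun ω _ => by split_ifs <;> simp [hμ.1 ω]

lemma kv_le_pmass {Ω S : Type*} [Fintype Ω] {μ : Ω → ℝ} (hμ : IsProb μ) (X : Ω → S) (ω : Ω) :
    μ ω ≤ pmass μ X (X ω) := by
  unfold pmass
  have := Finset.single_le_sum (f := fun ω' => if X ω' = X ω then μ ω' else 0)
    (fun ω' _ => by split_ifs <;> simp [hμ.1 ω']) (Finset.mem_univ ω)
  simpa using this

lemma kv_sum_pmass {Ω S : Type*} [Fintype Ω] (μ : Ω → ℝ) (X : Ω → S) (f : S → ℝ) :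
    ∑ s ∈ Finset.univ.image X, pmass μ X s * f s = ∑ ω, μ ω * f (X ω) := by
  unfold pmass
  simp_rw [Finset.sum_mul]
  rw [Finset.sum_comm]
  refine Finset.sum_congr rfl fun ω _ => ?_
  simp [ite_mul]

lemma kv_sum_le_one {Ω S : Type*} [Fintype Ω] {μ : Ω → ℝ} (hμ : IsProb μ) (X : Ω → S)
    (F : Finset S) : ∑ s ∈ F, pmass μ X s ≤ 1 := by
  unfold pmass
  rw [Finset.sum_comm, ← hμ.2]
  refine Finset.sum_le_sum fun ω _ => ?_
  rw [Finset.sum_ite_eq]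
  split_ifs <;> simp [hμ.1 ω]

lemma kv_sum_one {Ω S : Type*} [Fintype Ω] {μ : Ω → ℝ} (hμ : IsProb μ) (X : Ω → S) :
    ∑ s ∈ Finset.univ.image X, pmass μ X s = 1 := by
  have := kv_sum_pmass μ X (fun _ => 1)
  simpa [hμ.2] using this

lemma kv_ent {Ω S : Type*} [Fintype Ω] (μ : Ω → ℝ) (X : Ω → S) :
    ent μ X = ∑ ω, μ ω * (- Real.log (pmass μ X (X ω))) := by
  rw [← kv_sum_pmass μ X (fun s => - Real.log (pmass μ X s))]
  unfold ent Real.negMulLog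
  exact Finset.sum_congr rfl fun s _ => by ring

lemma kv_expect {Ω S T U : Type*} [Fintype Ω] {μ : Ω → ℝ}
    {X : Ω → S} {Y : Ω → T} {Z : Ω → U} (h : IndepTriple μ X Y Z) (f : S → T → U → ℝ) :
    ∑ ω, μ ω * f (X ω) (Y ω) (Z ω) =
      ∑ x ∈ Finset.univ.image X, ∑ y ∈ Finset.univ.image Y, ∑ z ∈ Finset.univ.image Z,
        pmass μ X x * pmass μ Y y * pmass μ Z z * f x y z := by
  rw [← kv_sum_pmass μ (fun ω => (X ω, Y ω, Z ω)) (fun p => f p.1 p.2.1 p.2.2)]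
  have e : ∀ F : S × T × U → ℝ, ∑ x ∈ Finset.univ.image X, ∑ y ∈ Finset.univ.image Y,
      ∑ z ∈ Finset.univ.image Z, F (x, y, z) =
      ∑ v ∈ Finset.univ.image X ×ˢ Finset.univ.image Y ×ˢ Finset.univ.image Z, F v := by
    intro F
    rw [Finset.sum_product]
    refine Finset.sum_congr rfl fun x _ => ?_
    rw [Finset.sum_product]
  simp_rw [← h _ _ _]
  rw [e (fun v => pmass μ (fun ω => (X ω, Y ω, Z ω)) v * f v.1 v.2.1 v.2.2)]
  refine Finset.sum_subset ?_ ?_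
  · intro v hv
    simp only [Finset.mem_image, Finset.mem_univ, true_and] at hv
    obtain ⟨ω, rfl⟩ := hv
    simp
  · intro v _ hv
    have : pmass μ (fun ω => (X ω, Y ω, Z ω)) v = 0 := by
      unfold pmass
      refine Finset.sum_eq_zero fun ω _ => ?_
      rw [if_neg]
      rintro rfl
      apply hv
      simp only [Finset.mem_image, Finset.mem_univ, true_and]
      exact ⟨ω, rfl⟩
    rw [this, zero_mul]

lemma kv_conv_le {Ω G : Type*} [AddCommGroup G] [Fintype Ω] {μ : Ω → ℝ} (hμ : IsProb μ)
    {X W : Ω → G} (h : IndepPair μ X W) (F : Finset G) (s : G) :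
    ∑ x ∈ F, pmass μ X x * pmass μ W (s - x) ≤ pmass μ (fun ω => X ω + W ω) s := by
  simp_rw [← h _ _]
  unfold pmass
  rw [Finset.sum_comm]
  refine Finset.sum_le_sum fun ω _ => ?_
  trans ∑ x ∈ F, if X ω = x then (if X ω + W ω = s then μ ω else 0) else 0
  · refine le_of_eq (Finset.sum_congr rfl fun x _ => ?_)
    by_cases hx : X ω = x
    · subst hx
      simp [eq_sub_iff_add_eq, add_comm]
    · simp [hx]
  rw [Finset.sum_ite_eq]
  have := hμ.1 ω
  split_ifs <;> simp [this]

lemma kv_indep {Ω G : Type*} [AddCommGroup G] [Fintype Ω] {μ : Ω → ℝ} (hμ : IsProb μ)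
    {X Y Z : Ω → G} (h : IndepTriple μ X Y Z) : IndepPair μ X (fun ω => Y ω + Z ω) := by
  intro a t
  have e1 := kv_expect h (fun x y z => if x = a then (if y + z = t then 1 else 0) else 0)
  have e2 := kv_expect h (fun x y z => if y + z = t then 1 else 0)
  have l1 : pmass μ (fun ω => (X ω, Y ω + Z ω)) (a, t) = ∑ ω, μ ω *
      (if X ω = a then (if Y ω + Z ω = t then 1 else 0) else 0) := by
    unfold pmass
    refine Finset.sum_congr rfl fun ω _ => ?_
    by_cases h1 : X ω = a <;> by_cases h2 : Y ω + Z ω = t <;> simp [h1, h2]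
  have l2 : pmass μ (fun ω => Y ω + Z ω) t = ∑ ω, μ ω *
      (if Y ω + Z ω = t then 1 else 0) := by
    unfold pmass
    refine Finset.sum_congr rfl fun ω _ => ?_
    by_cases h2 : Y ω + Z ω = t <;> simp [h2]
  have e3 : ∀ c : G → ℝ, (∑ x ∈ Finset.univ.image X, ∑ y ∈ Finset.univ.image Y,
      ∑ z ∈ Finset.univ.image Z, pmass μ X x * pmass μ Y y * pmass μ Z z *
        (c x * (if y + z = t then 1 else 0))) = (∑ x ∈ Finset.univ.image X, pmass μ X x * c x) *
      ∑ y ∈ Finset.univ.image Y, ∑ z ∈ Finset.univ.image Z, pmass μ Y y * pmass μ Z z *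
        (if y + z = t then 1 else 0) := by
    intro c
    rw [Finset.sum_mul]
    refine Finset.sum_congr rfl fun x _ => ?_
    rw [Finset.mul_sum]
    refine Finset.sum_congr rfl fun y _ => ?_
    rw [Finset.mul_sum]
    refine Finset.sum_congr rfl fun z _ => ?_
    ring
  have e4 := e3 (fun x => if x = a then 1 else 0)
  have e5 := e3 (fun x => 1)
  simp only [ite_mul, one_mul, zero_mul] at e4 e5
  rw [l1, l2, e1, e2, e4, e5]
  rw [kv_sum_pmass μ X (fun x => if x = a then 1 else 0)]
  simp only [mul_one, kv_sum_one hμ X, one_mul]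
  congr 1
  unfold pmass
  simp

/-- **The Kaimanovich–Vershik–Madiman inequality (Lemma A.1).** For independent
`X, Y, Z` taking values in an abelian group:
`H[X + Y + Z] - H[X + Y] ≤ H[Y + Z] - H[Y]`. -/
theorem kaimanovich_vershik {G Ω : Type*} [AddCommGroup G] [Fintype Ω]
    (μ : Ω → ℝ) (hμ : IsProb μ) (X Y Z : Ω → G) (hindep : IndepTriple μ X Y Z) :
    ent μ (fun ω => X ω + Y ω + Z ω) - ent μ (fun ω => X ω + Y ω)
      ≤ ent μ (fun ω => Y ω + Z ω) - ent μ Y := by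
  have hxyz : IndepPair μ X (fun ω => Y ω + Z ω) := kv_indep hμ hindep
  have hzxy : IndepPair μ Z (fun ω => X ω + Y ω) := by
    apply kv_indep hμ
    intro z x y
    have := hindep x y z
    rw [show pmass μ Z z * pmass μ X x * pmass μ Y y = pmass μ X x * pmass μ Y y * pmass μ Z z by
      ring, ← this]
    unfold pmass
    refine Finset.sum_congr rfl fun ω _ => ?_
    simp only [Prod.mk.injEq]
    congr 1
    apply propext
    tauto
  have hpair : IndepPair μ (fun ω => X ω + Y ω) Z := by
    intro u z
    rw [mul_comm, ← hzxy z u]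
    unfold pmass
    refine Finset.sum_congr rfl fun ω _ => ?_
    simp only [Prod.mk.injEq]
    congr 1
    apply propext
    tauto
  set p := pmass μ X with hp
  set q := pmass μ Y with hq
  set r := pmass μ Z with hr
  set a := pmass μ (fun ω => X ω + Y ω) with ha
  set b := pmass μ (fun ω => Y ω + Z ω) with hb
  set c := pmass μ (fun ω => X ω + Y ω + Z ω) with hc
  have p0 : ∀ g, 0 ≤ p g := kv_pmass_nonneg hμ _
  have q0 : ∀ g, 0 ≤ q g := kv_pmass_nonneg hμ _
  have r0 : ∀ g, 0 ≤ r g := kv_pmass_nonneg hμ _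
  have a0 : ∀ g, 0 ≤ a g := kv_pmass_nonneg hμ _
  have b0 : ∀ g, 0 ≤ b g := kv_pmass_nonneg hμ _
  have c0 : ∀ g, 0 ≤ c g := kv_pmass_nonneg hμ _
  have conv1 : ∀ (F : Finset G) s, ∑ x ∈ F, p x * b (s - x) ≤ c s := by
    intro F s
    have := kv_conv_le hμ hxyz F s
    simpa only [← add_assoc] using this
  have conv2 : ∀ (F : Finset G) s, ∑ x ∈ F, a x * r (s - x) ≤ c s := by
    intro F s
    exact kv_conv_le hμ hpair F s
  -- the key sum
  let g : G × G × G → ℝ := fun v => (a v.2.1 * r (v.1 - v.2.1)) * (p v.2.2 * b (v.1 - v.2.2)) / c v.1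
  have g0 : ∀ v, 0 ≤ g v := fun v => div_nonneg (mul_nonneg (mul_nonneg (a0 _) (r0 _))
    (mul_nonneg (p0 _) (b0 _))) (c0 _)
  have gsum : ∀ F1 F2 F3 : Finset G, ∑ v ∈ F1 ×ˢ F2 ×ˢ F3, g v ≤ 1 := by
    intro F1 F2 F3
    rw [Finset.sum_product]
    refine le_trans (Finset.sum_le_sum fun s _ => ?_)
      (kv_sum_le_one hμ (fun ω => X ω + Y ω + Z ω) F1)
    rw [Finset.sum_product]
    have : ∑ u ∈ F2, ∑ x ∈ F3, g (s, u, x) =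
        (∑ u ∈ F2, a u * r (s - u)) * (∑ x ∈ F3, p x * b (s - x)) / c s := by
      rw [Finset.sum_mul_sum, Finset.sum_div]
      refine Finset.sum_congr rfl fun u _ => ?_
      rw [Finset.sum_div]
    rw [this]
    change _ ≤ c s
    refine div_le_of_le_mul₀ (c0 _) (c0 _) ?_
    exact mul_le_mul (conv2 _ _) (conv1 _ _)
      (Finset.sum_nonneg fun x _ => mul_nonneg (p0 _) (b0 _)) (c0 _)
  have key : ∑ ω, μ ω * (a (X ω + Y ω) * b (Y ω + Z ω) / (c (X ω + Y ω + Z ω) * q (Y ω))) ≤ 1 := by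
    rw [kv_expect hindep (fun x y z => a (x + y) * b (y + z) / (c (x + y + z) * q y))]
    set A := Finset.univ.image X
    set B := Finset.univ.image Y
    set C := Finset.univ.image Z
    let φ : G × G × G → G × G × G := fun v => (v.1 + v.2.1 + v.2.2, v.1 + v.2.1, v.1)
    have φinj : Function.Injective φ := by
      rintro ⟨x, y, z⟩ ⟨x', y', z'⟩ h
      simp only [φ, Prod.mk.injEq] at h
      obtain ⟨h1, h2, h3⟩ := h
      subst h3
      have h4 := add_left_cancel h2
      subst h4
      have h5 := add_left_cancel h1
      subst h5
      rfl
    calc _ ≤ ∑ x ∈ A, ∑ y ∈ B, ∑ z ∈ C, g (φ (x, y, z)) := by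
          refine Finset.sum_le_sum fun x _ => Finset.sum_le_sum fun y _ =>
            Finset.sum_le_sum fun z _ => ?_
          by_cases hy : q y = 0
          · change p x * q y * r z * _ ≤ _
            rw [hy]
            simpa using g0 _
          · apply le_of_eq
            simp only [g, φ]
            rw [show x + y + z - (x + y) = z by abel, show x + y + z - x = y + z by abel]
            change p x * q y * r z * _ = _
            by_cases hcc : c (x + y + z) = 0
            · simp [hcc]
            · field_simp
      _ = ∑ v ∈ A ×ˢ B ×ˢ C, g (φ v) := by
          rw [Finset.sum_product]
          refine Finset.sum_congr rfl fun x _ => ?_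
          rw [Finset.sum_product]
      _ = ∑ v ∈ (A ×ˢ B ×ˢ C).image φ, g v := by
          rw [Finset.sum_image (fun _ _ _ _ h => φinj h)]
      _ ≤ ∑ v ∈ (((A ×ˢ B ×ˢ C).image φ).image fun v => v.1) ×ˢ
            (((A ×ˢ B ×ˢ C).image φ).image fun v => v.2.1) ×ˢ
            (((A ×ˢ B ×ˢ C).image φ).image fun v => v.2.2), g v := by
          refine Finset.sum_le_sum_of_subset_of_nonneg ?_ fun v _ _ => g0 v
          intro v hv
          simp only [Finset.mem_product]
          exact ⟨Finset.mem_image_of_mem (fun v : G × G × G => v.1) hv,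
            Finset.mem_image_of_mem (fun v : G × G × G => v.2.1) hv,
            Finset.mem_image_of_mem (fun v : G × G × G => v.2.2) hv⟩
      _ ≤ 1 := gsum _ _ _
  rw [kv_ent μ Y, kv_ent μ (fun ω => X ω + Y ω), kv_ent μ (fun ω => Y ω + Z ω),
    kv_ent μ (fun ω => X ω + Y ω + Z ω)]
  have main : ∑ ω, (μ ω * (-Real.log (c (X ω + Y ω + Z ω))) - μ ω * (-Real.log (a (X ω + Y ω)))
      - (μ ω * (-Real.log (b (Y ω + Z ω))) - μ ω * (-Real.log (q (Y ω))))) ≤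
      ∑ ω, (μ ω * (a (X ω + Y ω) * b (Y ω + Z ω) / (c (X ω + Y ω + Z ω) * q (Y ω))) - μ ω) := by
    refine Finset.sum_le_sum fun ω _ => ?_
    rcases (hμ.1 ω).eq_or_lt with h0 | h0
    · simp [← h0]
    · have qa : 0 < q (Y ω) := h0.trans_le (kv_le_pmass hμ Y ω)
      have aa : 0 < a (X ω + Y ω) := h0.trans_le (kv_le_pmass hμ (fun ω => X ω + Y ω) ω)
      have ba : 0 < b (Y ω + Z ω) := h0.trans_le (kv_le_pmass hμ (fun ω => Y ω + Z ω) ω)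
      have ca : 0 < c (X ω + Y ω + Z ω) :=
        h0.trans_le (kv_le_pmass hμ (fun ω => X ω + Y ω + Z ω) ω)
      have hl := Real.log_le_sub_one_of_pos (div_pos (mul_pos aa ba) (mul_pos ca qa))
      rw [Real.log_div (mul_pos aa ba).ne' (mul_pos ca qa).ne', Real.log_mul aa.ne' ba.ne',
        Real.log_mul ca.ne' qa.ne'] at hl
      have := mul_le_mul_of_nonneg_left hl h0.le
      linarith
  simp only [Finset.sum_sub_distrib] at main
  rw [hμ.2] at main
  linarith

end
end

section
/- Let G = F_2^n, fix finitely supported G-valued random variables X_1^0, X_2^0, set η = 1/9, and define τ[X_1; X_2] := d[X_1; X_2] + η·d[X_1^0; X_1] + η·d[X_2^0; X_2]. Suppose X_1, X_2 are finitely supported G-valued random variables with d[X_1; X_2] = k, satisfying τ[X_1'; X_2'] ≥ τ[X_1; X_2] for every pair of finitely supported G-valued random variables X_1', X_2'. Let X_1, X_2, X̃_1, X̃_2 be jointly independent, with X̃_1 a copy of X_1 and X̃_2 a copy of X_2. Then I_1 := I[X_1 + X_2 : X̃_1 + X_2 | X_1 + X_2 + X̃_1 + X̃_2] ≤ 2ηk.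 -/
open scoped Classical BigOperators Pointwise
open Finset

noncomputable section

section helpers

variable {Ω Ω' S T U V G : Type*} [Fintype Ω] [Fintype Ω']

/-- product weight -/
def prw (μ : Ω → ℝ) (ν : Ω' → ℝ) : Ω × Ω' → ℝ := fun p => μ p.1 * ν p.2

lemma pmass_nonneg {μ : Ω → ℝ} (h : ∀ ω, 0 ≤ μ ω) (X : Ω → S) (s : S) : 0 ≤ pmass μ X s :=
  Finset.sum_nonneg fun ω _ => by split_ifs <;> simp [h]

lemma le_pmass {μ : Ω → ℝ} (h : ∀ ω, 0 ≤ μ ω) (X : Ω → S) (ω : Ω) : μ ω ≤ pmass μ X (X ω) := by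
  have := Finset.single_le_sum (f := fun ω' => if X ω' = X ω then μ ω' else 0)
    (fun i _ => by split_ifs <;> simp [h]) (Finset.mem_univ ω)
  simpa [pmass] using this

lemma pmass_congr (μ : Ω → ℝ) (X : Ω → S) (Y : Ω → T) (s : S) (t : T)
    (h : ∀ ω, X ω = s ↔ Y ω = t) : pmass μ X s = pmass μ Y t := by
  unfold pmass
  refine Finset.sum_congr rfl fun ω _ => ?_
  by_cases hx : X ω = s
  · rw [if_pos hx, if_pos ((h ω).1 hx)]
  · rw [if_neg hx, if_neg (fun hy => hx ((h ω).2 hy))]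

lemma sum_pmass_mul [Fintype S] (μ : Ω → ℝ) (X : Ω → S) (f : S → ℝ) :
    ∑ s, pmass μ X s * f s = ∑ ω, μ ω * f (X ω) := by
  unfold pmass
  simp_rw [Finset.sum_mul]
  rw [Finset.sum_comm]
  refine Finset.sum_congr rfl fun ω _ => ?_
  rw [Finset.sum_eq_single (X ω)]
  · simp
  · intro b _ hb
    rw [if_neg (Ne.symm hb), zero_mul]
  · simp

lemma sum_pmass [Fintype S] (μ : Ω → ℝ) (X : Ω → S) : ∑ s, pmass μ X s = ∑ ω, μ ω := by
  simpa using sum_pmass_mul μ X (fun _ => 1)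

lemma pmass_isProb [Fintype S] {μ : Ω → ℝ} (h : IsProb μ) (X : Ω → S) : IsProb (pmass μ X) :=
  ⟨pmass_nonneg h.1 X, by rw [sum_pmass, h.2]⟩

lemma pmass_eq_zero (μ : Ω → ℝ) (X : Ω → S) (s : S) (h : s ∉ Finset.univ.image X) :
    pmass μ X s = 0 := by
  unfold pmass
  refine Finset.sum_eq_zero fun ω _ => ?_
  rw [if_neg]
  rintro rfl
  exact h (Finset.mem_image_of_mem _ (Finset.mem_univ _))

lemma sum_image_eq [Fintype S] (μ : Ω → ℝ) (X : Ω → S) (f : S → ℝ)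
    (hf : ∀ s, pmass μ X s = 0 → f s = 0) :
    ∑ s ∈ Finset.univ.image X, f s = ∑ s, f s :=
  Finset.sum_subset (Finset.subset_univ _) fun s _ hs => hf s (pmass_eq_zero μ X s hs)

lemma ent_univ [Fintype S] (μ : Ω → ℝ) (X : Ω → S) :
    ent μ X = ∑ s, Real.negMulLog (pmass μ X s) :=
  sum_image_eq μ X _ fun s hs => by simp [hs]

lemma ent_eq [Fintype S] (μ : Ω → ℝ) (X : Ω → S) :
    ent μ X = ∑ ω, μ ω * (- Real.log (pmass μ X (X ω))) := by
  rw [ent_univ, ← sum_pmass_mul μ X (fun s => - Real.log (pmass μ X s))]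
  refine Finset.sum_congr rfl fun s _ => ?_
  rw [Real.negMulLog]; ring

lemma ent_congr [Fintype S] [Fintype T] (μ : Ω → ℝ) (X : Ω → S) (Y : Ω → T)
    (h : ∀ ω ω', X ω = X ω' ↔ Y ω = Y ω') : ent μ X = ent μ Y := by
  rw [ent_eq, ent_eq]
  refine Finset.sum_congr rfl fun ω _ => ?_
  rw [pmass_congr μ X Y (X ω) (Y ω) fun ω' => h ω' ω]

lemma pmass_map [Fintype S] (μ : Ω → ℝ) (X : Ω → S) (f : S → T) (t : T) :
    pmass μ (fun ω => f (X ω)) t = pmass (pmass μ X) f t := by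
  have := sum_pmass_mul μ X (fun s => if f s = t then 1 else 0)
  simp only [mul_ite, mul_one, mul_zero] at this
  exact this.symm

lemma ent_map [Fintype S] [Fintype T] (μ : Ω → ℝ) (X : Ω → S) (f : S → T) :
    ent μ (fun ω => f (X ω)) = ent (pmass μ X) f := by
  rw [ent_univ, ent_univ]
  simp_rw [pmass_map]

lemma prw_isProb {μ : Ω → ℝ} {ν : Ω' → ℝ} (hμ : IsProb μ) (hν : IsProb ν) : IsProb (prw μ ν) := by
  refine ⟨fun p => mul_nonneg (hμ.1 _) (hν.1 _), ?_⟩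
  simp only [prw, Fintype.sum_prod_type]
  simp_rw [← Finset.mul_sum, hν.2, mul_one, hμ.2]

lemma pmass_prw (μ : Ω → ℝ) (ν : Ω' → ℝ) (X : Ω → S) (Y : Ω' → T) (s : S) (t : T) :
    pmass (prw μ ν) (fun p => (X p.1, Y p.2)) (s, t) = pmass μ X s * pmass ν Y t := by
  unfold pmass prw
  rw [Finset.sum_mul_sum, Fintype.sum_prod_type]
  refine Finset.sum_congr rfl fun a _ => Finset.sum_congr rfl fun b _ => ?_
  by_cases h1 : X a = s <;> by_cases h2 : Y b = t <;> simp [h1, h2]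

lemma pmass_prw_fst {μ : Ω → ℝ} {ν : Ω' → ℝ} (hν : IsProb ν) (X : Ω → S) (s : S) :
    pmass (prw μ ν) (fun p => X p.1) s = pmass μ X s := by
  unfold pmass prw
  rw [Fintype.sum_prod_type]
  refine Finset.sum_congr rfl fun a _ => ?_
  by_cases h1 : X a = s <;> simp [h1, ← Finset.mul_sum, hν.2]

lemma pmass_prw_snd {μ : Ω → ℝ} {ν : Ω' → ℝ} (hμ : IsProb μ) (Y : Ω' → S) (s : S) :
    pmass (prw μ ν) (fun p => Y p.2) s = pmass ν Y s := by
  unfold pmass prw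
  rw [Fintype.sum_prod_type_right]
  refine Finset.sum_congr rfl fun a _ => ?_
  by_cases h1 : Y a = s <;> simp [h1, ← Finset.sum_mul, hμ.2]

lemma indep_prw {μ : Ω → ℝ} {ν : Ω' → ℝ} (hμ : IsProb μ) (hν : IsProb ν)
    (X : Ω → S) (Y : Ω' → T) :
    IndepPair (prw μ ν) (fun p => X p.1) (fun p => Y p.2) := by
  intro s t
  rw [pmass_prw, pmass_prw_fst hν, pmass_prw_snd hμ]

lemma ent_prw_fst [Fintype S] {μ : Ω → ℝ} {ν : Ω' → ℝ} (hν : IsProb ν) (X : Ω → S) :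
    ent (prw μ ν) (fun p => X p.1) = ent μ X := by
  rw [ent_univ, ent_univ]; simp_rw [pmass_prw_fst hν]

lemma ent_prw_snd [Fintype S] {μ : Ω → ℝ} {ν : Ω' → ℝ} (hμ : IsProb μ) (Y : Ω' → S) :
    ent (prw μ ν) (fun p => Y p.2) = ent ν Y := by
  rw [ent_univ, ent_univ]; simp_rw [pmass_prw_snd hμ]

lemma ent_indep [Fintype S] [Fintype T] {μ : Ω → ℝ} (hμ : IsProb μ) {X : Ω → S} {Y : Ω → T}
    (h : IndepPair μ X Y) : ent μ (fun ω => (X ω, Y ω)) = ent μ X + ent μ Y := by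
  rw [ent_eq, ent_eq, ent_eq, ← Finset.sum_add_distrib]
  refine Finset.sum_congr rfl fun ω _ => ?_
  rw [h]
  rcases eq_or_lt_of_le (hμ.1 ω) with h0 | h0
  · simp [← h0]
  · rw [Real.log_mul (h0.trans_le (le_pmass hμ.1 X ω)).ne' (h0.trans_le (le_pmass hμ.1 Y ω)).ne']
    ring

lemma IndepPair.law {μ : Ω → ℝ} {X : Ω → S} {Y : Ω → T} [Fintype S] [Fintype T]
    (h : IndepPair μ X Y) :
    pmass μ (fun ω => (X ω, Y ω)) = prw (pmass μ X) (pmass μ Y) := by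
  funext ⟨s, t⟩
  exact h s t

lemma IndepPair.comp [Fintype S] [Fintype T] {μ : Ω → ℝ} {X : Ω → S} {Y : Ω → T}
    (h : IndepPair μ X Y) (f : S → U) (g : T → V) :
    IndepPair μ (fun ω => f (X ω)) (fun ω => g (Y ω)) := by
  intro u v
  rw [pmass_map μ (fun ω => (X ω, Y ω)) (fun p => (f p.1, g p.2)), h.law, pmass_prw,
    pmass_map μ X f, pmass_map μ Y g]

lemma IndepPair.symm {μ : Ω → ℝ} {X : Ω → S} {Y : Ω → T} (h : IndepPair μ X Y) :
    IndepPair μ Y X := by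
  intro t s
  rw [mul_comm, ← h s t]
  exact pmass_congr _ _ _ _ _ fun ω => by simp [and_comm]

/-- entropy of a function of an independent pair depends only on the two laws -/
lemma ent_indep_map [Fintype S] [Fintype T] [Fintype U] {μ : Ω → ℝ} {X : Ω → S} {Y : Ω → T}
    (h : IndepPair μ X Y) (f : S → T → U) :
    ent μ (fun ω => f (X ω) (Y ω)) =
      ent (prw (pmass μ X) (pmass μ Y)) (fun p => f p.1 p.2) := by
  rw [← h.law, ← ent_map]

lemma ent_prw_map [Fintype S] [Fintype T] [Fintype U] (μ : Ω → ℝ) (ν : Ω' → ℝ)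
    (X : Ω → S) (Y : Ω' → T) (f : S → T → U) :
    ent (prw μ ν) (fun p => f (X p.1) (Y p.2)) =
      ent (prw (pmass μ X) (pmass ν Y)) (fun p => f p.1 p.2) := by
  have : prw (pmass μ X) (pmass ν Y) = pmass (prw μ ν) (fun p => (X p.1, Y p.2)) := by
    funext ⟨s, t⟩
    rw [pmass_prw]; rfl
  rw [this, ← ent_map]

lemma sum_pmass_snd [Fintype S] [Fintype T] (μ : Ω → ℝ) (X : Ω → S) (Y : Ω → T) (t : T) :
    ∑ s, pmass μ (fun ω => (X ω, Y ω)) (s, t) = pmass μ Y t := by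
  unfold pmass
  rw [Finset.sum_comm]
  refine Finset.sum_congr rfl fun ω _ => ?_
  by_cases h : Y ω = t <;> simp [h]

lemma sum_pmass_fst [Fintype S] [Fintype T] (μ : Ω → ℝ) (X : Ω → S) (Y : Ω → T) (s : S) :
    ∑ t, pmass μ (fun ω => (X ω, Y ω)) (s, t) = pmass μ X s := by
  unfold pmass
  rw [Finset.sum_comm]
  refine Finset.sum_congr rfl fun ω _ => ?_
  by_cases h : X ω = s <;> simp [h]

lemma submod [Fintype S] [Fintype T] [Fintype U] {μ : Ω → ℝ} (hμ : IsProb μ)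
    (X : Ω → S) (Y : Ω → T) (Z : Ω → U) :
    ent μ (fun ω => (X ω, Y ω, Z ω)) + ent μ Z ≤
      ent μ (fun ω => (X ω, Z ω)) + ent μ (fun ω => (Y ω, Z ω)) := by
  set p3 := pmass μ (fun ω => (X ω, Y ω, Z ω)) with hp3
  set pxz := pmass μ (fun ω => (X ω, Z ω)) with hpxz
  set pyz := pmass μ (fun ω => (Y ω, Z ω)) with hpyz
  set pz := pmass μ Z with hpz
  have n3 : ∀ a, 0 ≤ p3 a := pmass_nonneg hμ.1 _
  have nxz : ∀ a, 0 ≤ pxz a := pmass_nonneg hμ.1 _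
  have nyz : ∀ a, 0 ≤ pyz a := pmass_nonneg hμ.1 _
  have nz : ∀ a, 0 ≤ pz a := pmass_nonneg hμ.1 _
  let f : S × T × U → ℝ := fun a => pxz (a.1, a.2.2) * pyz (a.2.1, a.2.2) / (p3 a * pz a.2.2)
  have key : ∑ ω, μ ω * f (X ω, Y ω, Z ω) ≤ 1 := by
    rw [← sum_pmass_mul μ (fun ω => (X ω, Y ω, Z ω)) f, ← hp3]
    have h1 : ∀ a : S × T × U, p3 a * f a ≤
        pxz (a.1, a.2.2) * pyz (a.2.1, a.2.2) / pz a.2.2 := by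
      intro a
      have nn : 0 ≤ pxz (a.1, a.2.2) * pyz (a.2.1, a.2.2) / pz a.2.2 :=
        div_nonneg (mul_nonneg (nxz _) (nyz _)) (nz _)
      rcases eq_or_lt_of_le (n3 a) with h0 | h0
      · rw [← h0, zero_mul]; exact nn
      · apply le_of_eq
        simp only [f]
        rw [mul_div_assoc', mul_div_mul_left _ _ h0.ne']
    refine (Finset.sum_le_sum fun a _ => h1 a).trans ?_
    rw [Fintype.sum_prod_type]
    simp_rw [Fintype.sum_prod_type_right]
    rw [Finset.sum_comm]
    have h2 : ∀ z, ∑ x, ∑ y, pxz (x, z) * pyz (y, z) / pz z = pz z := by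
      intro z
      simp_rw [← Finset.sum_div, ← Finset.sum_mul_sum]
      rw [hpxz, hpyz, sum_pmass_snd, sum_pmass_snd, ← hpz]
      exact mul_self_div_self _
    simp_rw [h2]
    rw [hpz, sum_pmass, hμ.2]
  rw [ent_eq, ent_eq, ent_eq, ent_eq, ← Finset.sum_add_distrib, ← Finset.sum_add_distrib]
  have h3 : ∀ ω, μ ω * -Real.log (p3 (X ω, Y ω, Z ω)) + μ ω * -Real.log (pz (Z ω)) ≤
      (μ ω * -Real.log (pxz (X ω, Z ω)) + μ ω * -Real.log (pyz (Y ω, Z ω)))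
        + (μ ω * f (X ω, Y ω, Z ω) - μ ω) := by
    intro ω
    rcases eq_or_lt_of_le (hμ.1 ω) with h0 | h0
    · simp [← h0]
    · have a3 : 0 < p3 (X ω, Y ω, Z ω) := h0.trans_le (le_pmass hμ.1 _ ω)
      have axz : 0 < pxz (X ω, Z ω) := h0.trans_le (le_pmass hμ.1 (fun ω => (X ω, Z ω)) ω)
      have ayz : 0 < pyz (Y ω, Z ω) := h0.trans_le (le_pmass hμ.1 (fun ω => (Y ω, Z ω)) ω)
      have az : 0 < pz (Z ω) := h0.trans_le (le_pmass hμ.1 _ ω)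
      have hf : 0 < f (X ω, Y ω, Z ω) := by simp only [f]; positivity
      have hl := Real.log_le_sub_one_of_pos hf
      have : Real.log (f (X ω, Y ω, Z ω)) = Real.log (pxz (X ω, Z ω)) + Real.log (pyz (Y ω, Z ω))
          - (Real.log (p3 (X ω, Y ω, Z ω)) + Real.log (pz (Z ω))) := by
        simp only [f]
        rw [Real.log_div (by positivity) (by positivity), Real.log_mul axz.ne' ayz.ne',
          Real.log_mul a3.ne' az.ne']
      rw [this] at hl
      nlinarith [mul_le_mul_of_nonneg_left hl h0.le]
  have h4 := Finset.sum_le_sum fun ω (_ : ω ∈ Finset.univ) => h3 ω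
  rw [Finset.sum_add_distrib (f := fun ω => μ ω * -Real.log (pxz (X ω, Z ω)) + _),
    Finset.sum_sub_distrib, hμ.2] at h4
  linarith

lemma subadd [Fintype S] [Fintype T] {μ : Ω → ℝ} (hμ : IsProb μ)
    (X : Ω → S) (Y : Ω → T) :
    ent μ (fun ω => (X ω, Y ω)) ≤ ent μ X + ent μ Y := by
  have h := submod hμ X Y (fun _ => ())
  have h0 : ent μ (fun _ => ()) = 0 := by
    rw [ent_univ]; simp [pmass, hμ.2]
  rw [h0, ent_congr μ (fun ω => (X ω, Y ω, ())) (fun ω => (X ω, Y ω)) (by simp),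
    ent_congr μ (fun ω => (X ω, ())) X (by simp),
    ent_congr μ (fun ω => (Y ω, ())) Y (by simp)] at h
  linarith

lemma condMeas_isProb {μ : Ω → ℝ} (hμ : IsProb μ) (Z : Ω → U) (z : U) (hz : pmass μ Z z ≠ 0) :
    IsProb (condMeas μ Z z) := by
  constructor
  · intro ω
    unfold condMeas
    split_ifs
    · exact div_nonneg (hμ.1 _) (pmass_nonneg hμ.1 _ _)
    · exact le_rfl
  · have : ∑ ω, condMeas μ Z z ω = pmass μ Z z / pmass μ Z z := by
      conv_rhs => rw [pmass, Finset.sum_div]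
      refine Finset.sum_congr rfl fun ω _ => ?_
      unfold condMeas
      split_ifs
      · rfl
      · simp
    rw [this, div_self hz]

lemma pmass_condMeas (μ : Ω → ℝ) (X : Ω → S) (Z : Ω → U) (s : S) (z : U) :
    pmass (condMeas μ Z z) X s = pmass μ (fun ω => (X ω, Z ω)) (s, z) / pmass μ Z z := by
  conv_rhs => rw [pmass, Finset.sum_div]
  rw [pmass]
  refine Finset.sum_congr rfl fun ω _ => ?_
  unfold condMeas
  by_cases h1 : X ω = s <;> by_cases h2 : Z ω = z <;> simp [h1, h2]

lemma chain [Fintype S] [Fintype U] {μ : Ω → ℝ} (hμ : IsProb μ) (X : Ω → S) (Z : Ω → U) :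
    ∑ z, pmass μ Z z * ent (condMeas μ Z z) X = ent μ (fun ω => (X ω, Z ω)) - ent μ Z := by
  have h1 : ∀ z, pmass μ Z z * ent (condMeas μ Z z) X =
      ∑ ω, if Z ω = z then
        μ ω * (- Real.log (pmass μ (fun ω => (X ω, Z ω)) (X ω, Z ω)) + Real.log (pmass μ Z (Z ω)))
        else 0 := by
    intro z
    rw [ent_eq, Finset.mul_sum]
    refine Finset.sum_congr rfl fun ω _ => ?_
    rw [pmass_condMeas]
    unfold condMeas
    split_ifs with hz
    · subst hz
      rcases eq_or_lt_of_le (hμ.1 ω) with h0 | h0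
      · simp [← h0]
      · have a : 0 < pmass μ Z (Z ω) := h0.trans_le (le_pmass hμ.1 _ ω)
        have b : 0 < pmass μ (fun ω => (X ω, Z ω)) (X ω, Z ω) :=
          h0.trans_le (le_pmass hμ.1 (fun ω => (X ω, Z ω)) ω)
        rw [Real.log_div b.ne' a.ne']
        field_simp
        ring
    · simp
  simp_rw [h1]
  rw [Finset.sum_comm, ent_eq, ent_eq, ← Finset.sum_sub_distrib]
  refine Finset.sum_congr rfl fun ω _ => ?_
  rw [Finset.sum_ite_eq]
  simp
  ring

lemma condMutualInfo_eq [Fintype S] [Fintype T] [Fintype U] {μ : Ω → ℝ} (hμ : IsProb μ)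
    (X : Ω → S) (Y : Ω → T) (Z : Ω → U) :
    condMutualInfo μ X Y Z = ent μ (fun ω => (X ω, Z ω)) + ent μ (fun ω => (Y ω, Z ω))
      - ent μ (fun ω => ((X ω, Y ω), Z ω)) - ent μ Z := by
  unfold condMutualInfo
  rw [sum_image_eq μ Z _ (fun s hs => by simp [hs])]
  simp_rw [mutualInfo, mul_sub, mul_add]
  rw [Finset.sum_sub_distrib, Finset.sum_add_distrib, chain hμ, chain hμ, chain hμ]
  ring

lemma condMeas_prw (μ : Ω → ℝ) (ν : Ω' → ℝ) (Z : Ω → S) (W : Ω' → T) (z : S) (w : T) :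
    prw (condMeas μ Z z) (condMeas ν W w) =
      condMeas (prw μ ν) (fun p => (Z p.1, W p.2)) (z, w) := by
  funext ⟨a, b⟩
  simp only [condMeas, pmass_prw]
  by_cases h1 : Z a = z <;> by_cases h2 : W b = w <;> simp [prw, condMeas, h1, h2, div_mul_div_comm]

lemma rdist_eq [AddCommGroup G] (μ : Ω → ℝ) (X : Ω → G) (ν : Ω' → ℝ) (Y : Ω' → G) :
    rdist μ X ν Y = ent (prw μ ν) (fun p => X p.1 - Y p.2) - ent μ X / 2 - ent ν Y / 2 := rfl

lemma cond_avg [Fintype G] [AddCommGroup G] [Fintype S] [Fintype T] {μ : Ω → ℝ} {ν : Ω' → ℝ}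
    (hμ : IsProb μ) (hν : IsProb ν) (X : Ω → G) (Y : Ω' → G) (Z : Ω → S) (W : Ω' → T) :
    ∑ z, ∑ w, pmass μ Z z * pmass ν W w * rdist (condMeas μ Z z) X (condMeas ν W w) Y =
      ent (prw μ ν) (fun p => (X p.1 - Y p.2, (Z p.1, W p.2))) - ent μ Z - ent ν W
      - (ent μ (fun ω => (X ω, Z ω)) - ent μ Z) / 2
      - (ent ν (fun ω => (Y ω, W ω)) - ent ν W) / 2 := by
  have h1 := chain (prw_isProb hμ hν) (fun p : Ω × Ω' => X p.1 - Y p.2) (fun p => (Z p.1, W p.2))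
  rw [Fintype.sum_prod_type, ent_indep (prw_isProb hμ hν) (indep_prw hμ hν Z W),
    ent_prw_fst hν, ent_prw_snd hμ] at h1
  simp_rw [pmass_prw, ← condMeas_prw] at h1
  simp_rw [rdist_eq, mul_sub, Finset.sum_sub_distrib]
  rw [h1, ← chain hμ X Z, ← chain hν Y W]
  have h2 : ∑ z, ∑ w, pmass μ Z z * pmass ν W w * (ent (condMeas μ Z z) X / 2) =
      (∑ z, pmass μ Z z * ent (condMeas μ Z z) X) / 2 := by
    rw [Finset.sum_div]
    refine Finset.sum_congr rfl fun z _ => ?_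
    rw [← Finset.sum_mul, ← Finset.mul_sum, sum_pmass, hν.2]; ring
  have h3 : ∑ z, ∑ w, pmass μ Z z * pmass ν W w * (ent (condMeas ν W w) Y / 2) =
      (∑ w, pmass ν W w * ent (condMeas ν W w) Y) / 2 := by
    rw [Finset.sum_comm, Finset.sum_div]
    refine Finset.sum_congr rfl fun w _ => ?_
    rw [← Finset.sum_mul, ← Finset.sum_mul, sum_pmass, hμ.2]; ring
  rw [h2, h3]; ring

lemma condMeas_unit {ν : Ω' → ℝ} (hν : IsProb ν) : condMeas ν (fun _ => ()) () = ν := by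
  funext ω
  simp [condMeas, pmass, hν.2]

lemma cond_avg_right [Fintype G] [AddCommGroup G] [Fintype T] {μ : Ω → ℝ} {ν : Ω' → ℝ}
    (hμ : IsProb μ) (hν : IsProb ν) (X : Ω → G) (Y : Ω' → G) (W : Ω' → T) :
    ∑ w, pmass ν W w * rdist μ X (condMeas ν W w) Y =
      ent (prw μ ν) (fun p => (X p.1 - Y p.2, W p.2)) - ent ν W - ent μ X / 2
      - (ent ν (fun ω => (Y ω, W ω)) - ent ν W) / 2 := by
  have h := cond_avg hμ hν X Y (fun _ => ()) W
  have h0 : ent μ (fun _ => ()) = 0 := by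
    rw [ent_univ]; simp [pmass, hμ.2]
  have h1 : pmass μ (fun _ => ()) () = 1 := by simp [pmass, hμ.2]
  rw [ent_congr μ (fun ω => (X ω, ())) X (by simp), h0,
    ent_congr (prw μ ν) (fun p => (X p.1 - Y p.2, ((), W p.2)))
      (fun p => (X p.1 - Y p.2, W p.2)) (by simp)] at h
  simp only [Finset.univ_unique, Finset.sum_singleton, PUnit.default_eq_unit, h1, one_mul,
    condMeas_unit hμ] at h
  rw [h]; ring

lemma kv [Fintype G] [AddCommGroup G] {μ : Ω → ℝ} (hμ : IsProb μ) (A B C : Ω → G)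
    (h1 : IndepPair μ A (fun ω => (B ω, C ω))) (h2 : IndepPair μ B C) :
    ent μ (fun ω => A ω + (B ω + C ω)) + ent μ B ≤
      ent μ (fun ω => A ω + B ω) + ent μ (fun ω => B ω + C ω) := by
  have h3 : IndepPair μ (fun ω => (A ω, B ω)) C := by
    rintro ⟨a, b⟩ c
    have e1 := h1 a (b, c)
    have e2 := (h1.comp (fun a => a) Prod.fst) a b
    simp only at e2
    rw [e2, mul_assoc, ← h2 b c, ← e1]
    exact pmass_congr _ _ _ _ _ fun ω => by simp [and_assoc]
  have s := submod hμ A (fun ω => A ω + B ω) (fun ω => A ω + (B ω + C ω))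
  have i1 := ent_indep hμ (h1.comp (fun a => a) (fun p => p.1 + p.2))
  have i2 := ent_indep hμ (h3.comp (fun p => p.1 + p.2) (fun c => c))
  have i3 := ent_indep hμ h1
  have i4 := ent_indep hμ h2
  simp only at i1 i2
  rw [ent_congr μ (fun ω => (A ω, A ω + (B ω + C ω))) (fun ω => (A ω, B ω + C ω)) (by
      intro ω ω'; simp only [Prod.mk.injEq]
      constructor
      · rintro ⟨h, h'⟩; rw [h] at h'; exact ⟨h, add_left_cancel h'⟩
      · rintro ⟨h, h'⟩; rw [h, h']; exact ⟨rfl, rfl⟩), i1,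
    ent_congr μ (fun ω => (A ω + B ω, A ω + (B ω + C ω))) (fun ω => (A ω + B ω, C ω)) (by
      intro ω ω'; simp only [Prod.mk.injEq, ← add_assoc]
      constructor
      · rintro ⟨h, h'⟩; rw [h] at h'; exact ⟨h, add_left_cancel h'⟩
      · rintro ⟨h, h'⟩; rw [h, h']; exact ⟨rfl, rfl⟩), i2,
    ent_congr μ (fun ω => (A ω, A ω + B ω, A ω + (B ω + C ω))) (fun ω => (A ω, B ω, C ω)) (by
      intro ω ω'; simp only [Prod.mk.injEq]
      constructor
      · rintro ⟨h, h', h''⟩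
        rw [h] at h' h''
        have := add_left_cancel h'
        rw [this] at h''
        exact ⟨h, this, add_left_cancel (add_left_cancel h'')⟩
      · rintro ⟨h, h', h''⟩; rw [h, h', h'']; exact ⟨rfl, rfl, rfl⟩), i3, i4] at s
  linarith

lemma IndepFour.pair [Fintype S] [Fintype T] [Fintype U] [Fintype V] {μ : Ω → ℝ} (hμ : IsProb μ)
    {A : Ω → S} {B : Ω → T} {C : Ω → U} {D : Ω → V} (h : IndepFour μ A B C D) :
    IndepPair μ A B := by
  intro s t
  rw [← sum_pmass_fst μ (fun ω => (A ω, B ω)) (fun ω => (C ω, D ω)) (s, t)]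
  have : ∀ c : U × V, pmass μ (fun ω => ((A ω, B ω), (C ω, D ω))) ((s, t), c) =
      pmass μ A s * pmass μ B t * (pmass μ C c.1 * pmass μ D c.2) := by
    rintro ⟨u, v⟩
    have := h s t u v
    rw [mul_assoc (_ * _)] at this
    rw [← this]
    exact pmass_congr _ _ _ _ _ fun ω => by simp [and_assoc]
  simp_rw [this]
  rw [← Finset.mul_sum, Fintype.sum_prod_type, ← Finset.sum_mul_sum, sum_pmass, sum_pmass, hμ.2]
  ring

lemma IndepFour.rot {μ : Ω → ℝ}
    {A : Ω → S} {B : Ω → T} {C : Ω → U} {D : Ω → V} (h : IndepFour μ A B C D) :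
    IndepFour μ B C D A := by
  intro t u v s
  have := h s t u v
  rw [show pmass μ B t * pmass μ C u * pmass μ D v * pmass μ A s =
    pmass μ A s * pmass μ B t * pmass μ C u * pmass μ D v by ring, ← this]
  exact pmass_congr _ _ _ _ _ fun ω => by simp only [Prod.mk.injEq]; tauto

lemma IndepFour.swap {μ : Ω → ℝ}
    {A : Ω → S} {B : Ω → T} {C : Ω → U} {D : Ω → V} (h : IndepFour μ A B C D) :
    IndepFour μ B A C D := by
  intro t s u v
  have := h s t u v
  rw [show pmass μ B t * pmass μ A s * pmass μ C u * pmass μ D v =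
    pmass μ A s * pmass μ B t * pmass μ C u * pmass μ D v by ring, ← this]
  exact pmass_congr _ _ _ _ _ fun ω => by simp only [Prod.mk.injEq]; tauto

lemma IndepFour.pairs [Fintype S] [Fintype T] [Fintype U] [Fintype V] {μ : Ω → ℝ} (hμ : IsProb μ)
    {A : Ω → S} {B : Ω → T} {C : Ω → U} {D : Ω → V} (h : IndepFour μ A B C D) :
    IndepPair μ (fun ω => (A ω, B ω)) (fun ω => (C ω, D ω)) := by
  rintro ⟨s, t⟩ ⟨u, v⟩
  rw [h.pair hμ, h.rot.rot.pair hμ, ← mul_assoc, ← h s t u v]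
  exact pmass_congr _ _ _ _ _ fun ω => by simp [and_assoc]

end helpers

/-- **The first estimate (Section 5).** If `(X₁, X₂)` is a `τ`-minimizer (with `η = 1/9`,
`τ[X₁';X₂'] := d[X₁';X₂'] + η d[X₁⁰;X₁'] + η d[X₂⁰;X₂']`), `X̃₁, X̃₂` are independent
copies, and `k := d[X₁;X₂]`, then
`I₁ := I[X₁ + X₂ : X̃₁ + X₂ | X₁ + X₂ + X̃₁ + X̃₂] ≤ 2ηk`. -/
theorem first_estimate {n : ℕ} {Ω₀₁ Ω₀₂ Ω : Type} [Fintype Ω₀₁] [Fintype Ω₀₂] [Fintype Ω]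
    (μ₀₁ : Ω₀₁ → ℝ) (μ₀₂ : Ω₀₂ → ℝ) (μ : Ω → ℝ)
    (hμ₀₁ : IsProb μ₀₁) (hμ₀₂ : IsProb μ₀₂) (hμ : IsProb μ)
    (X₀₁ : Ω₀₁ → (Fin n → ZMod 2)) (X₀₂ : Ω₀₂ → (Fin n → ZMod 2))
    (X₁ X₂ Y₁ Y₂ : Ω → (Fin n → ZMod 2))
    (hindep : IndepFour μ X₁ X₂ Y₁ Y₂)
    (hY₁ : IdentDist μ Y₁ μ X₁) (hY₂ : IdentDist μ Y₂ μ X₂)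
    (k : ℝ) (hk : rdist μ X₁ μ X₂ = k)
    (hmin : ∀ (Ω₁' : Type) [Fintype Ω₁'] (Ω₂' : Type) [Fintype Ω₂']
      (μ₁' : Ω₁' → ℝ) (μ₂' : Ω₂' → ℝ), IsProb μ₁' → IsProb μ₂' →
      ∀ (X₁' : Ω₁' → (Fin n → ZMod 2)) (X₂' : Ω₂' → (Fin n → ZMod 2)),
        rdist μ X₁ μ X₂ + (1/9) * rdist μ₀₁ X₀₁ μ X₁ + (1/9) * rdist μ₀₂ X₀₂ μ X₂
          ≤ rdist μ₁' X₁' μ₂' X₂' + (1/9) * rdist μ₀₁ X₀₁ μ₁' X₁'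
            + (1/9) * rdist μ₀₂ X₀₂ μ₂' X₂') :
    condMutualInfo μ (fun ω => X₁ ω + X₂ ω) (fun ω => Y₁ ω + X₂ ω)
        (fun ω => X₁ ω + X₂ ω + Y₁ ω + Y₂ ω)
      ≤ 2 * (1/9) * k := by
  have sub_add : ∀ a b : Fin n → ZMod 2, a - b = a + b := fun a b => by
    funext i; simp [CharTwo.sub_eq_add]
  have add_self : ∀ a : Fin n → ZMod 2, a + a = 0 := fun a => by
    funext i; exact CharTwo.add_self_eq_zero _
  -- independence
  have iX1X2_Y1Y2 := hindep.pairs hμ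
  have hi2 : IndepFour μ X₁ Y₂ X₂ Y₁ := by
    have := hindep.rot.rot.rot.swap
    exact this
  have hi3 : IndepFour μ Y₁ X₂ X₁ Y₂ := hindep.rot.swap.rot.rot.swap.rot.rot
  have iX1Y2_X2Y1 := hi2.pairs hμ
  have iY1X2_X1Y2 := hi3.pairs hμ
  have i12 := hindep.pair hμ
  have i1Y2 := hi2.pair hμ
  have iY1Y2 := hindep.rot.rot.pair hμ
  have i2Y1 := hi2.rot.rot.pair hμ
  have iY12 := hi3.pair hμ
  have eY1 : pmass μ Y₁ = pmass μ X₁ := funext hY₁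
  have eY2 : pmass μ Y₂ = pmass μ X₂ := funext hY₂
  -- common entropies
  obtain ⟨h, hh⟩ : ∃ h, h = ent μ (fun ω => X₁ ω + X₂ ω) := ⟨_, rfl⟩
  have h12 := ent_indep_map i12 (fun a b => a + b)
  have h1Y2 : ent μ (fun ω => X₁ ω + Y₂ ω) = h := by
    rw [hh, h12, ent_indep_map i1Y2 (fun a b => a + b), eY2]
  have hY1Y2 : ent μ (fun ω => Y₁ ω + Y₂ ω) = h := by
    rw [hh, h12, ent_indep_map iY1Y2 (fun a b => a + b), eY1, eY2]
  have hY12 : ent μ (fun ω => Y₁ ω + X₂ ω) = h := by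
    rw [hh, h12, ent_indep_map iY12 (fun a b => a + b), eY1]
  have h2Y1 : ent μ (fun ω => X₂ ω + Y₁ ω) = h := by
    rw [← hY12]; simp_rw [add_comm]
  have entY1 : ent μ Y₁ = ent μ X₁ := by rw [ent_univ, ent_univ, eY1]
  have entY2 : ent μ Y₂ = ent μ X₂ := by rw [ent_univ, ent_univ, eY2]
  have kk : k = h - ent μ X₁ / 2 - ent μ X₂ / 2 := by
    rw [← hk, rdist_eq, ent_prw_map μ μ X₁ X₂ (fun a b => a - b), hh, h12]
    simp_rw [sub_add]
  -- joint entropies of pairs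
  have j1 : ent μ (fun ω => (X₁ ω, X₁ ω + Y₂ ω)) = ent μ X₁ + ent μ X₂ := by
    rw [← entY2, ← ent_indep hμ i1Y2]
    refine ent_congr _ _ _ fun ω ω' => ?_
    simp only [Prod.mk.injEq]
    constructor
    · rintro ⟨e, e'⟩; rw [e] at e'; exact ⟨e, add_left_cancel e'⟩
    · rintro ⟨e, e'⟩; rw [e, e']; exact ⟨rfl, rfl⟩
  have j2 : ent μ (fun ω => (X₂ ω, X₂ ω + Y₁ ω)) = ent μ X₂ + ent μ X₁ := by
    rw [← entY1, ← ent_indep hμ i2Y1]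
    refine ent_congr _ _ _ fun ω ω' => ?_
    simp only [Prod.mk.injEq]
    constructor
    · rintro ⟨e, e'⟩; rw [e] at e'; exact ⟨e, add_left_cancel e'⟩
    · rintro ⟨e, e'⟩; rw [e, e']; exact ⟨rfl, rfl⟩
  -- the conditional mutual information
  obtain ⟨T, hT⟩ : ∃ T, T = ent μ (fun ω => (X₁ ω + X₂ ω, (X₁ ω + Y₂ ω, X₂ ω + Y₁ ω))) := ⟨_, rfl⟩
  obtain ⟨s, hs⟩ : ∃ s, s = ent μ (fun ω => X₁ ω + X₂ ω + Y₁ ω + Y₂ ω) := ⟨_, rfl⟩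
  have I1 : condMutualInfo μ (fun ω => X₁ ω + X₂ ω) (fun ω => Y₁ ω + X₂ ω)
      (fun ω => X₁ ω + X₂ ω + Y₁ ω + Y₂ ω) = 4 * h - T - s := by
    rw [condMutualInfo_eq hμ, ← hs]
    have a1 : ent μ (fun ω => (X₁ ω + X₂ ω, X₁ ω + X₂ ω + Y₁ ω + Y₂ ω)) = h + h := by
      have := ent_indep hμ (iX1X2_Y1Y2.comp (fun p => p.1 + p.2) (fun p => p.1 + p.2))
      simp only [← hh, hY1Y2] at this
      rw [← this]
      refine ent_congr _ _ _ fun ω ω' => ?_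
      simp only [Prod.mk.injEq, add_assoc (X₁ _ + X₂ _)]
      constructor
      · rintro ⟨e, e'⟩; rw [e] at e'; exact ⟨e, add_left_cancel e'⟩
      · rintro ⟨e, e'⟩; rw [e, e']; exact ⟨rfl, rfl⟩
    have a2 : ent μ (fun ω => (Y₁ ω + X₂ ω, X₁ ω + X₂ ω + Y₁ ω + Y₂ ω)) = h + h := by
      have := ent_indep hμ (iY1X2_X1Y2.comp (fun p => p.1 + p.2) (fun p => p.1 + p.2))
      simp only [hY12, h1Y2] at this
      rw [← this]
      refine ent_congr _ _ _ fun ω ω' => ?_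
      have r : ∀ ω, X₁ ω + X₂ ω + Y₁ ω + Y₂ ω = (Y₁ ω + X₂ ω) + (X₁ ω + Y₂ ω) := fun ω => by abel
      simp only [Prod.mk.injEq, r]
      constructor
      · rintro ⟨e, e'⟩; rw [e] at e'; exact ⟨e, add_left_cancel e'⟩
      · rintro ⟨e, e'⟩; rw [e, e']; exact ⟨rfl, rfl⟩
    have a3 : ent μ (fun ω => ((X₁ ω + X₂ ω, Y₁ ω + X₂ ω), X₁ ω + X₂ ω + Y₁ ω + Y₂ ω)) = T := by
      rw [hT]
      refine ent_congr _ _ _ fun ω ω' => ?_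
      have r : ∀ ω, X₁ ω + X₂ ω + Y₁ ω + Y₂ ω = (X₂ ω + Y₁ ω) + (X₁ ω + Y₂ ω) := fun ω => by abel
      simp only [Prod.mk.injEq, r, add_comm (Y₁ _) (X₂ _)]
      constructor
      · rintro ⟨⟨e, e'⟩, e''⟩; rw [e'] at e''; exact ⟨e, add_left_cancel e'', e'⟩
      · rintro ⟨e, e', e''⟩; rw [e, e', e'']; exact ⟨⟨rfl, rfl⟩, rfl⟩
    rw [a1, a2, a3]; ring
  -- first use of minimality
  have m1 := hmin Ω Ω μ μ hμ hμ (fun ω => X₁ ω + Y₂ ω) (fun ω => X₂ ω + Y₁ ω)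
  have d1 : rdist μ (fun ω => X₁ ω + Y₂ ω) μ (fun ω => X₂ ω + Y₁ ω) = s - h := by
    have e := ent_prw_map μ μ (fun ω => (X₁ ω, Y₂ ω)) (fun ω => (X₂ ω, Y₁ ω))
      (fun a b => (a.1 + a.2) - (b.1 + b.2))
    rw [← ent_indep_map iX1Y2_X2Y1 (fun a b => (a.1 + a.2) - (b.1 + b.2))] at e
    simp only at e
    have e2 : s = ent μ (fun ω => (X₁ ω + Y₂ ω) - (X₂ ω + Y₁ ω)) := by
      rw [hs]; congr 1; funext ω; rw [sub_add]; abel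
    rw [rdist_eq, e, ← e2, h1Y2, h2Y1]; ring
  -- second use of minimality
  obtain ⟨τ, hτ⟩ : ∃ τ, τ = rdist μ X₁ μ X₂ + (1/9) * rdist μ₀₁ X₀₁ μ X₁
    + (1/9) * rdist μ₀₂ X₀₂ μ X₂ := ⟨_, rfl⟩
  rw [← hτ] at m1
  obtain ⟨Z, hZ⟩ : ∃ Z : Ω → (Fin n → ZMod 2), Z = fun ω => X₁ ω + Y₂ ω := ⟨_, rfl⟩
  obtain ⟨W, hW⟩ : ∃ W : Ω → (Fin n → ZMod 2), W = fun ω => X₂ ω + Y₁ ω := ⟨_, rfl⟩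
  have m2 : τ ≤ ∑ z, ∑ w, pmass μ Z z * pmass μ W w * rdist (condMeas μ Z z) X₁ (condMeas μ W w) X₂
      + (1/9) * ∑ z, pmass μ Z z * rdist μ₀₁ X₀₁ (condMeas μ Z z) X₁
      + (1/9) * ∑ w, pmass μ W w * rdist μ₀₂ X₀₂ (condMeas μ W w) X₂ := by
    have pz := pmass_isProb hμ Z
    have pw := pmass_isProb hμ W
    have l : τ = ∑ z, ∑ w, pmass μ Z z * pmass μ W w * τ := by
      simp_rw [← Finset.sum_mul, ← Finset.mul_sum, pw.2, mul_one, pz.2, one_mul]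
    have r : ∑ z, ∑ w, pmass μ Z z * pmass μ W w *
        (rdist (condMeas μ Z z) X₁ (condMeas μ W w) X₂
          + (1/9) * rdist μ₀₁ X₀₁ (condMeas μ Z z) X₁
          + (1/9) * rdist μ₀₂ X₀₂ (condMeas μ W w) X₂) =
        ∑ z, ∑ w, pmass μ Z z * pmass μ W w * rdist (condMeas μ Z z) X₁ (condMeas μ W w) X₂
        + (1/9) * ∑ z, pmass μ Z z * rdist μ₀₁ X₀₁ (condMeas μ Z z) X₁
        + (1/9) * ∑ w, pmass μ W w * rdist μ₀₂ X₀₂ (condMeas μ W w) X₂ := by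
      simp_rw [mul_add, Finset.sum_add_distrib]
      congr 1
      · congr 1
        rw [Finset.mul_sum]
        refine Finset.sum_congr rfl fun z _ => ?_
        rw [← Finset.sum_mul, ← Finset.mul_sum, pw.2]; ring
      · rw [Finset.mul_sum, Finset.sum_comm]
        refine Finset.sum_congr rfl fun w _ => ?_
        rw [← Finset.sum_mul, ← Finset.sum_mul, pz.2]; ring
    rw [← r]
    conv_lhs => rw [l]
    refine Finset.sum_le_sum fun z _ => Finset.sum_le_sum fun w _ => ?_
    by_cases hz : pmass μ Z z = 0
    · simp [hz]
    by_cases hw : pmass μ W w = 0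
    · simp [hw]
    refine mul_le_mul_of_nonneg_left ?_ (mul_nonneg (pz.1 _) (pw.1 _))
    rw [hτ]
    exact hmin Ω Ω _ _ (condMeas_isProb hμ Z z hz) (condMeas_isProb hμ W w hw) X₁ X₂
  rw [cond_avg hμ hμ, cond_avg_right hμ₀₁ hμ, cond_avg_right hμ₀₂ hμ] at m2
  have d2 : ent (prw μ μ) (fun p => (X₁ p.1 - X₂ p.2, (Z p.1, W p.2))) = T := by
    have e := ent_prw_map μ μ (fun ω => (X₁ ω, Y₂ ω)) (fun ω => (X₂ ω, Y₁ ω))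
      (fun a b => (a.1 - b.1, (a.1 + a.2, b.1 + b.2)))
    rw [← ent_indep_map iX1Y2_X2Y1 (fun a b => (a.1 - b.1, (a.1 + a.2, b.1 + b.2)))] at e
    simp only [sub_add] at e
    rw [hT, ← e, hZ, hW]
    simp only [sub_add]
  have u1 := subadd (prw_isProb hμ₀₁ hμ) (fun p => X₀₁ p.1 - X₁ p.2) (fun p => Z p.2)
  have u2 := subadd (prw_isProb hμ₀₂ hμ) (fun p => X₀₂ p.1 - X₂ p.2) (fun p => W p.2)
  rw [ent_prw_snd hμ₀₁] at u1
  rw [ent_prw_snd hμ₀₂] at u2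
  have v1 := kv (prw_isProb hμ₀₁ hμ) (fun p => X₀₁ p.1) (fun p => X₁ p.2) (fun p => Y₂ p.2)
    (indep_prw hμ₀₁ hμ X₀₁ (fun ω => (X₁ ω, Y₂ ω)))
    (fun a b => by
      rw [pmass_prw_snd hμ₀₁ (fun ω => (X₁ ω, Y₂ ω)), pmass_prw_snd hμ₀₁, pmass_prw_snd hμ₀₁]
      exact i1Y2 a b)
  have v2 := kv (prw_isProb hμ₀₂ hμ) (fun p => X₀₂ p.1) (fun p => X₂ p.2) (fun p => Y₁ p.2)
    (indep_prw hμ₀₂ hμ X₀₂ (fun ω => (X₂ ω, Y₁ ω)))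
    (fun a b => by
      rw [pmass_prw_snd hμ₀₂ (fun ω => (X₂ ω, Y₁ ω)), pmass_prw_snd hμ₀₂, pmass_prw_snd hμ₀₂]
      exact i2Y1 a b)
  rw [ent_prw_snd hμ₀₁, ent_prw_snd hμ₀₁ (fun ω => X₁ ω + Y₂ ω), h1Y2] at v1
  rw [ent_prw_snd hμ₀₂, ent_prw_snd hμ₀₂ (fun ω => X₂ ω + Y₁ ω), h2Y1] at v2
  have hZh : ent μ Z = h := by rw [hZ, h1Y2]
  have hWh : ent μ W = h := by rw [hW, h2Y1]
  have j1' : ent μ (fun ω => (X₁ ω, Z ω)) = ent μ X₁ + ent μ X₂ := by rw [hZ]; exact j1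
  have j2' : ent μ (fun ω => (X₂ ω, W ω)) = ent μ X₂ + ent μ X₁ := by rw [hW]; exact j2
  rw [d2, hZh, hWh, j1', j2'] at m2
  rw [hZh] at u1
  rw [hWh] at u2
  rw [d1, rdist_eq μ₀₁, rdist_eq μ₀₂, h1Y2, h2Y1] at m1
  rw [hk, rdist_eq μ₀₁, rdist_eq μ₀₂] at hτ
  simp only [sub_add] at m1 m2 u1 u2 hτ
  rw [I1]
  linarith

end
end

section
/- Let C' > 0 and suppose the following entropic statement holds: for every n and all finitely supported F_2^n-valued random variables X_1^0, X_2^0 there exists a subgroup H ≤ F_2^n such that d[X_1^0; U_H] + d[X_2^0; U_H] ≤ C'·d[X_1^0; X_2^0], where U_H is uniform on H. Then, for every n, every non-empty finite A ⊆ F_2^n with |A + A| ≤ K|A| (with K ≥ 1) is covered by at most 2K^{C'+1} cosets of some subgroup H ≤ F_2^n with |H| ≤ |A|. -/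
open scoped Classical BigOperators Pointwise
open Finset

noncomputable section

lemma my_sum_pmass {Ω S : Type*} [Fintype Ω] (μ : Ω → ℝ) (h : IsProb μ) (X : Ω → S) :
    ∑ s ∈ Finset.univ.image X, pmass μ X s = 1 := by
  unfold pmass
  rw [Finset.sum_comm, ← h.2]
  refine Finset.sum_congr rfl fun ω _ => ?_
  rw [Finset.sum_ite_eq]
  simp

lemma my_pmass_nonneg {Ω S : Type*} [Fintype Ω] (μ : Ω → ℝ) (h : IsProb μ) (X : Ω → S) (s : S) :
    0 ≤ pmass μ X s := by
  unfold pmass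
  refine Finset.sum_nonneg fun ω _ => ?_
  split_ifs
  · exact h.1 ω
  · exact le_rfl

lemma my_ent_le {Ω S : Type*} [Fintype Ω] (μ : Ω → ℝ) (h : IsProb μ) (X : Ω → S)
    (T : Finset S) (hT : ∀ ω, X ω ∈ T) : ent μ X ≤ Real.log T.card := by
  have h1 := my_sum_pmass μ h X
  have hsub : Finset.univ.image X ⊆ T := by
    intro s hs
    obtain ⟨ω, -, rfl⟩ := Finset.mem_image.1 hs
    exact hT ω
  have hne : (Finset.univ.image X).Nonempty := by
    by_contra hc
    rw [Finset.not_nonempty_iff_eq_empty] at hc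
    rw [hc] at h1
    simp at h1
  set N : ℝ := (T.card : ℝ) with hN
  have hNpos : 0 < N := by
    have := (hne.mono hsub).card_pos
    rw [hN]; exact_mod_cast this
  have key : ∀ s ∈ Finset.univ.image X, Real.negMulLog (pmass μ X s)
      ≤ pmass μ X s * Real.log N + (1 / N - pmass μ X s) := by
    intro s _
    rcases (my_pmass_nonneg μ h X s).eq_or_lt with h0 | h0
    · rw [← h0]; simp [hNpos.le]
    · have := Real.log_le_sub_one_of_pos (x := 1 / (pmass μ X s * N)) (by positivity)
      rw [one_div, Real.log_inv, Real.log_mul h0.ne' hNpos.ne'] at this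
      have h2 := mul_le_mul_of_nonneg_left this h0.le
      have h3 : pmass μ X s * ((pmass μ X s * N)⁻¹ - 1) = 1 / N - pmass μ X s := by
        field_simp
      rw [h3] at h2
      unfold Real.negMulLog
      linarith
  have h2 := Finset.sum_le_sum key
  rw [Finset.sum_add_distrib, ← Finset.sum_mul, Finset.sum_sub_distrib, h1] at h2
  have h3 : ∑ s ∈ Finset.univ.image X, 1 / N ≤ 1 := by
    rw [Finset.sum_const, nsmul_eq_mul, mul_one_div, div_le_one hNpos]
    rw [hN]; exact_mod_cast Finset.card_le_card hsub
  unfold ent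
  linarith

/-- Some value has mass at least exp (-ent). -/
lemma my_ent_ge {Ω S : Type*} [Fintype Ω] (μ : Ω → ℝ) (h : IsProb μ) (X : Ω → S) :
    ∃ s, 0 < pmass μ X s ∧ - Real.log (pmass μ X s) ≤ ent μ X := by
  have h1 := my_sum_pmass μ h X
  have hne : (Finset.univ.image X).Nonempty := by
    by_contra hc
    rw [Finset.not_nonempty_iff_eq_empty] at hc
    rw [hc] at h1
    simp at h1
  obtain ⟨s, hs, hmax⟩ := Finset.exists_max_image (Finset.univ.image X) (pmass μ X) hne
  have hpos : 0 < pmass μ X s := by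
    by_contra hc
    have : ∑ s ∈ Finset.univ.image X, pmass μ X s ≤ 0 :=
      Finset.sum_nonpos fun t ht => (hmax t ht).trans (not_lt.1 hc)
    linarith
  refine ⟨s, hpos, ?_⟩
  have key : ∀ t ∈ Finset.univ.image X, pmass μ X t * (- Real.log (pmass μ X s))
      ≤ Real.negMulLog (pmass μ X t) := by
    intro t ht
    rcases (my_pmass_nonneg μ h X t).eq_or_lt with h0 | h0
    · rw [← h0]; simp
    · have := Real.log_le_log h0 (hmax t ht)
      unfold Real.negMulLog
      nlinarith
  have h2 := Finset.sum_le_sum key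
  rw [← Finset.sum_mul, h1, one_mul] at h2
  exact h2

/-- Entropy when all nonzero masses equal c. -/
lemma my_ent_const {Ω S : Type*} [Fintype Ω] (μ : Ω → ℝ) (h : IsProb μ) (X : Ω → S) (c : ℝ)
    (hc : ∀ s, pmass μ X s = c ∨ pmass μ X s = 0) : ent μ X = - Real.log c := by
  have h1 := my_sum_pmass μ h X
  have : ent μ X = ∑ s ∈ Finset.univ.image X, pmass μ X s * (- Real.log c) := by
    refine Finset.sum_congr rfl fun s _ => ?_
    unfold Real.negMulLog
    rcases hc s with h | h <;> rw [h]
    · ring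
    · simp
  rw [this, ← Finset.sum_mul, h1, one_mul]

lemma my_isProb_prod {Ω₁ Ω₂ : Type*} [Fintype Ω₁] [Fintype Ω₂] (μ₁ : Ω₁ → ℝ) (μ₂ : Ω₂ → ℝ)
    (h₁ : IsProb μ₁) (h₂ : IsProb μ₂) : IsProb (fun p : Ω₁ × Ω₂ => μ₁ p.1 * μ₂ p.2) := by
  refine ⟨fun p => mul_nonneg (h₁.1 _) (h₂.1 _), ?_⟩
  rw [Fintype.sum_prod_type]
  simp only [← Finset.mul_sum, h₂.2, mul_one, h₁.2]

lemma my_isProb_unif {G : Type*} [Fintype G] [AddCommGroup G] (H : AddSubgroup G) :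
    IsProb (unifOn (H : Set G)) := by
  have hpos : (0 : ℝ) < Nat.card (H : Set G) := by
    have : 0 < Nat.card H := Nat.card_pos
    exact_mod_cast this
  constructor
  · intro g
    unfold unifOn
    split_ifs <;> positivity
  · unfold unifOn
    rw [← Finset.sum_filter, Finset.sum_const, nsmul_eq_mul]
    have : (Finset.univ.filter (fun g => g ∈ (H : Set G))).card = Nat.card (H : Set G) := by
      rw [Nat.card_eq_fintype_card, Fintype.card_subtype]
    rw [this]
    exact mul_inv_cancel₀ hpos.ne'

lemma my_ent_unif {G : Type*} [Fintype G] [AddCommGroup G] (H : AddSubgroup G) :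
    ent (unifOn (H : Set G)) (fun g => g) = Real.log (Nat.card H) := by
  rw [my_ent_const _ (my_isProb_unif H) _ ((Nat.card H : ℝ)⁻¹), Real.log_inv, neg_neg]
  intro s
  have : pmass (unifOn (H : Set G)) (fun g => g) s = unifOn (H : Set G) s := by
    unfold pmass
    simp
  rw [this]
  unfold unifOn
  split_ifs
  · left; rfl
  · right; rfl

lemma my_isProb_A {G : Type*} (A : Finset G) (hA : A.Nonempty) :
    IsProb (fun _ : A => ((A.card : ℝ))⁻¹) := by
  have : (0 : ℝ) < A.card := by exact_mod_cast hA.card_pos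
  refine ⟨fun _ => by positivity, ?_⟩
  simp [this.ne']

lemma my_ent_A {G : Type*} (A : Finset G) (hA : A.Nonempty) :
    ent (fun _ : A => ((A.card : ℝ))⁻¹) (fun a => (a : G)) = Real.log A.card := by
  rw [my_ent_const _ (my_isProb_A A hA) _ ((A.card : ℝ)⁻¹), Real.log_inv, neg_neg]
  intro s
  by_cases hs : s ∈ A
  · left
    unfold pmass
    rw [Finset.sum_eq_single (⟨s, hs⟩ : A)]
    · simp
    · intro b _ hb
      rw [if_neg]
      intro h
      exact hb (Subtype.ext h)
    · simp
  · right
    unfold pmass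
    refine Finset.sum_eq_zero fun a _ => ?_
    rw [if_neg]
    rintro rfl
    exact hs a.2

lemma my_pmass_diff {G : Type*} [Fintype G] [AddCommGroup G] (A : Finset G) (H : AddSubgroup G)
    (s : G) :
    pmass (fun p : A × G => ((A.card : ℝ))⁻¹ * unifOn (H : Set G) p.2) (fun p => (p.1 : G) - p.2) s
      = (A.filter (fun a => a - s ∈ H)).card * ((A.card : ℝ)⁻¹ * (Nat.card H : ℝ)⁻¹) := by
  unfold pmass
  rw [Fintype.sum_prod_type]
  have h1 : ∀ a : A, ∑ y : G, (if (a : G) - y = s then ((A.card : ℝ))⁻¹ * unifOn (H : Set G) y else 0)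
      = if (a : G) - s ∈ H then ((A.card : ℝ))⁻¹ * (Nat.card H : ℝ)⁻¹ else 0 := by
    intro a
    rw [Finset.sum_eq_single ((a : G) - s)]
    · rw [if_pos (by abel)]
      unfold unifOn
      simp only [SetLike.mem_coe, mul_ite, mul_zero]
      rfl
    · intro b _ hb
      rw [if_neg]
      rintro rfl
      exact hb (by abel)
    · simp
  simp only [h1]
  rw [Finset.sum_coe_sort A (fun a => if a - s ∈ H then ((A.card : ℝ))⁻¹ * (Nat.card H : ℝ)⁻¹ else 0),
    ← Finset.sum_filter, Finset.sum_const, nsmul_eq_mul]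

lemma my_subgroup {n : ℕ} (H : AddSubgroup (Fin n → ZMod 2)) (a : ℕ) (ha : 0 < a)
    (haH : a < Nat.card H) :
    ∃ H' : AddSubgroup (Fin n → ZMod 2), H' ≤ H ∧ Nat.card H' ≤ a ∧ a < 2 * Nat.card H' := by
  have hd : Nat.card H ∣ 2 ^ n := by
    have := AddSubgroup.card_addSubgroup_dvd_card H
    simpa using this
  obtain ⟨k, -, hk⟩ := (Nat.dvd_prime_pow Nat.prime_two).1 hd
  have h1 : 2 ^ Nat.log 2 a ≤ a := Nat.pow_log_le_self 2 ha.ne'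
  have h2 : a < 2 ^ (Nat.log 2 a + 1) := Nat.lt_pow_succ_log_self (by norm_num) a
  have hdv : 2 ^ Nat.log 2 a ∣ Nat.card (Multiplicative H) := by
    have : Nat.card (Multiplicative H) = 2 ^ k := hk
    rw [this]
    apply pow_dvd_pow
    have : 2 ^ Nat.log 2 a < 2 ^ k := by omega
    exact ((Nat.pow_lt_pow_iff_right (by norm_num)).1 this).le
  haveI : Fact (Nat.Prime 2) := ⟨Nat.prime_two⟩
  obtain ⟨L, hL⟩ := Sylow.exists_subgroup_card_pow_prime 2 hdv
  have hc : Nat.card ((Subgroup.toAddSubgroup' L).map H.subtype) = 2 ^ Nat.log 2 a := by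
    rw [AddSubgroup.card_map_of_injective H.subtype_injective]
    exact hL
  refine ⟨(Subgroup.toAddSubgroup' L).map H.subtype, ?_, ?_, ?_⟩
  · rintro x ⟨y, -, rfl⟩
    exact y.2
  · rw [hc]; exact h1
  · rw [hc]; rw [pow_succ] at h2; omega

/-- Cover a group by cosets of a subgroup. -/
lemma my_cover_sub {G : Type*} [Fintype G] [AddCommGroup G] (H H' : AddSubgroup G) (hle : H' ≤ H) :
    ∃ F : Finset G, (F.card : ℝ) ≤ (Nat.card H : ℝ) / Nat.card H' ∧
      (H : Set G) ⊆ (F : Set G) + (H' : Set G) := by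
  set A : Finset G := Finset.univ.filter (fun g => g ∈ H) with hA
  set B : Finset G := Finset.univ.filter (fun g => g ∈ H') with hB
  have cA : A.card = Nat.card H := by rw [Nat.card_eq_fintype_card, Fintype.card_subtype]
  have cB : B.card = Nat.card H' := by rw [Nat.card_eq_fintype_card, Fintype.card_subtype]
  have hBne : B.Nonempty := ⟨0, by simp [hB, H'.zero_mem]⟩
  have hBpos : (0 : ℝ) < B.card := by exact_mod_cast hBne.card_pos
  have hAB : A + B ⊆ A := by
    intro x hx
    obtain ⟨a, ha, b, hb, rfl⟩ := Finset.mem_add.1 hx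
    simp only [hA, hB, Finset.mem_filter, Finset.mem_univ, true_and] at *
    exact H.add_mem ha (hle hb)
  have hK : ((A + B).card : ℝ) ≤ (A.card / B.card : ℝ) * B.card := by
    rw [div_mul_cancel₀ _ hBpos.ne']
    exact_mod_cast Finset.card_le_card hAB
  obtain ⟨F, -, hF, hcov⟩ := Finset.ruzsa_covering_add hBne hK
  refine ⟨F, by rw [← cA, ← cB]; exact hF, ?_⟩
  intro x hx
  have hx' : x ∈ A := by simpa [hA] using hx
  obtain ⟨f, hf, d, hd, rfl⟩ := Finset.mem_add.1 (hcov hx')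
  obtain ⟨b, hb, b', hb', rfl⟩ := Finset.mem_sub.1 hd
  simp only [hB, Finset.mem_filter, Finset.mem_univ, true_and] at hb hb'
  exact Set.add_mem_add hf (H'.sub_mem hb hb')


open scoped Pointwise in
/-- **From entropic PFR to combinatorial PFR (Appendix B).** If the entropic PFR
statement holds with constant `C'`, then every non-empty `A ⊆ F_2^n` with
`|A + A| ≤ K|A|` is covered by at most `2 K^(C'+1)` cosets of a subgroup `H` with
`|H| ≤ |A|`. -/
theorem entropic_implies_combinatorial (C' : ℝ) (hC' : 0 < C')
    (hent : ∀ (n : ℕ) (Ω₁ : Type) [Fintype Ω₁] (Ω₂ : Type) [Fintype Ω₂]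
      (μ₁ : Ω₁ → ℝ) (μ₂ : Ω₂ → ℝ), IsProb μ₁ → IsProb μ₂ →
      ∀ (X₁ : Ω₁ → (Fin n → ZMod 2)) (X₂ : Ω₂ → (Fin n → ZMod 2)),
        ∃ H : AddSubgroup (Fin n → ZMod 2),
          rdist μ₁ X₁ (unifOn (H : Set (Fin n → ZMod 2))) (fun g => g)
              + rdist μ₂ X₂ (unifOn (H : Set (Fin n → ZMod 2))) (fun g => g)
            ≤ C' * rdist μ₁ X₁ μ₂ X₂) :
    ∀ (n : ℕ) (A : Finset (Fin n → ZMod 2)), A.Nonempty → ∀ K : ℝ, 1 ≤ K →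
      ((A + A).card : ℝ) ≤ K * A.card →
      ∃ (H : AddSubgroup (Fin n → ZMod 2)) (c : Finset (Fin n → ZMod 2)),
        Nat.card H ≤ A.card ∧
        (c.card : ℝ) ≤ 2 * K ^ (C' + 1) ∧
        (A : Set (Fin n → ZMod 2)) ⊆ (c : Set (Fin n → ZMod 2)) + (H : Set (Fin n → ZMod 2)) := by
  intro n A hA K hK hAK
  obtain ⟨H, hH⟩ := hent n A A (fun _ => ((A.card : ℝ))⁻¹) (fun _ => ((A.card : ℝ))⁻¹)
    (my_isProb_A A hA) (my_isProb_A A hA) (fun a => (a : Fin n → ZMod 2)) (fun a => (a : Fin n → ZMod 2))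
  have hApos : (0 : ℝ) < A.card := by exact_mod_cast hA.card_pos
  have hHpos : (0 : ℝ) < Nat.card H := by
    have : 0 < Nat.card H := Nat.card_pos
    exact_mod_cast this
  have hK0 : 0 < K := by linarith
  have e1 := my_ent_le _ (my_isProb_prod _ _ (my_isProb_A A hA) (my_isProb_A A hA))
    (fun p : A × A => (p.1 : Fin n → ZMod 2) - p.2) (A + A) (by
      intro p
      have : (p.1 : Fin n → ZMod 2) - p.2 = p.1 + p.2 := by
        ext i
        simp [CharTwo.sub_eq_add]
      rw [this]
      exact Finset.add_mem_add p.1.2 p.2.2)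
  have e2 : Real.log (A + A).card ≤ Real.log K + Real.log A.card := by
    rw [← Real.log_mul hK0.ne' hApos.ne']
    apply Real.log_le_log _ hAK
    exact_mod_cast (hA.add hA).card_pos
  obtain ⟨s, hs0, hs⟩ := my_ent_ge _ (my_isProb_prod _ _ (my_isProb_A A hA) (my_isProb_unif H))
    (fun p : A × (Fin n → ZMod 2) => (p.1 : Fin n → ZMod 2) - p.2)
  rw [my_pmass_diff] at hs hs0
  set B := A.filter (fun a => a - s ∈ H) with hB
  have hBpos : (0 : ℝ) < B.card := by
    by_contra hc
    have : (B.card : ℝ) = 0 := le_antisymm (not_lt.1 hc) (Nat.cast_nonneg _)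
    rw [this] at hs0
    simp at hs0
  have hBne : B.Nonempty := by
    rw [← Finset.card_pos]
    exact_mod_cast hBpos
  rw [Real.log_mul hBpos.ne' (by positivity), Real.log_mul (by positivity) (by positivity),
    Real.log_inv, Real.log_inv] at hs
  unfold rdist at hH
  rw [my_ent_A A hA, my_ent_unif] at hH
  set LA := Real.log A.card with hLA
  set LH := Real.log (Nat.card H) with hLH
  set LB := Real.log B.card with hLB
  set LK := Real.log K with hLK
  have hLK0 : 0 ≤ LK := Real.log_nonneg hK
  have main1 : LA + LH - C' * LK ≤ 2 * LB := by
    have := mul_le_mul_of_nonneg_left (e1.trans e2) hC'.le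
    nlinarith
  have hBA : LB ≤ LA := Real.log_le_log hBpos (by exact_mod_cast Finset.card_filter_le _ _)
  have hBH : LB ≤ LH := by
    apply Real.log_le_log hBpos
    have : B.card ≤ Nat.card H := by
      rw [Nat.card_eq_fintype_card, Fintype.card_subtype]
      apply Finset.card_le_card_of_injOn (fun a => a - s)
      · intro a ha
        simp only [hB, Finset.coe_filter, Set.mem_setOf_eq] at ha
        simpa using ha.2
      · intro a _ b _ hab
        exact sub_left_injective hab
    exact_mod_cast this
  -- covering
  have hcov : ((A + B).card : ℝ) ≤ (K * A.card / B.card) * B.card := by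
    rw [div_mul_cancel₀ _ hBpos.ne']
    refine le_trans ?_ hAK
    exact_mod_cast Finset.card_le_card (Finset.add_subset_add_left (Finset.filter_subset _ _))
  obtain ⟨F, -, hF, hFcov⟩ := Finset.ruzsa_covering_add hBne hcov
  have hAF : (A : Set (Fin n → ZMod 2)) ⊆ (F : Set (Fin n → ZMod 2)) + (H : Set (Fin n → ZMod 2)) := by
    intro x hx
    obtain ⟨f, hf, d, hd, rfl⟩ := Finset.mem_add.1 (hFcov hx)
    obtain ⟨b, hb, b', hb', rfl⟩ := Finset.mem_sub.1 hd
    simp only [hB, Finset.mem_filter] at hb hb'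
    refine Set.add_mem_add hf ?_
    have := H.sub_mem hb.2 hb'.2
    simpa using this
  have hKA : K * A.card / B.card = Real.exp (LK + LA - LB) := by
    rw [Real.exp_sub, Real.exp_add, hLK, hLA, hLB, Real.exp_log hK0, Real.exp_log hApos,
      Real.exp_log hBpos]
  have hKp : K ^ (C' + 1) = Real.exp (LK * (C' + 1)) := Real.rpow_def_of_pos hK0 _
  by_cases hle : Nat.card H ≤ A.card
  · refine ⟨H, F, hle, ?_, hAF⟩
    refine hF.trans ?_
    rw [hKA, hKp]
    have : Real.exp (LK + LA - LB) ≤ Real.exp (LK * (C' + 1)) := by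
      apply Real.exp_le_exp.2
      nlinarith
    have h0 := Real.exp_pos (LK * (C' + 1))
    linarith
  · obtain ⟨H', hH'H, hH'A, hH'2⟩ := my_subgroup H A.card hA.card_pos (not_le.1 hle)
    obtain ⟨E, hE, hEcov⟩ := my_cover_sub H H' hH'H
    have hH'pos : (0 : ℝ) < Nat.card H' := by
      have : 0 < Nat.card H' := Nat.card_pos
      exact_mod_cast this
    refine ⟨H', F + E, hH'A, ?_, ?_⟩
    · have h1 : ((F + E).card : ℝ) ≤ F.card * E.card := by
        exact_mod_cast Finset.card_add_le
      have h2 : (E.card : ℝ) ≤ 2 * Real.exp (LH - LA) := by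
        refine hE.trans ?_
        rw [Real.exp_sub, hLH, hLA, Real.exp_log hHpos, Real.exp_log hApos, ← mul_div_assoc,
          div_le_div_iff₀ hH'pos hApos]
        have : (A.card : ℝ) ≤ 2 * Nat.card H' := by exact_mod_cast hH'2.le
        nlinarith
      rw [hKA] at hF
      calc ((F + E).card : ℝ) ≤ F.card * E.card := h1
        _ ≤ Real.exp (LK + LA - LB) * (2 * Real.exp (LH - LA)) :=
          mul_le_mul hF h2 (Nat.cast_nonneg _) (Real.exp_pos _).le
        _ = 2 * Real.exp (LK + LH - LB) := by
          rw [mul_left_comm, ← Real.exp_add]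
          congr 2
          ring
        _ ≤ 2 * K ^ (C' + 1) := by
          rw [hKp]
          gcongr
          nlinarith
    · intro x hx
      obtain ⟨f, hf, h, hh, rfl⟩ := Set.mem_add.1 (hAF hx)
      obtain ⟨e, he, h', hh', rfl⟩ := Set.mem_add.1 (hEcov hh)
      change f + (e + h') ∈ _
      rw [← add_assoc]
      refine Set.add_mem_add ?_ hh'
      rw [Finset.mem_coe]
      exact Finset.add_mem_add hf he

end
end
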